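/- Consider the multiplex network: for 1 ≤ i ≤ N and 1 ≤ k ≤ K, the states x_i^k(t) ∈ ℝ^n evolve according to d/dt x_i^k(t) = f(x_i^k(t)) + c Σ_{j=1}^N a_{ij} x_j^k(t) + d Σ_{l=1}^K b_{kl} x_i^l(t) for all t ≥ 0, where f satisfies the QUAD condition with constant α, c, d ≥ 0, the intra-layer coupling matrix A = (a_{ij}) is a Laplacian-type coupling matrix with second-eigenvalue bound μ_2, and the inter-layer coupling matrix B = (b_{kl}) is a Laplacian-type coupling matrix with second-eigenvalue bound ν_2. If c μ_2 + α < 0, then the multiplex network realizes intra-layer synchronization: for every layer k and all 1 ≤ p,q ≤ N, ‖x_p^k(t) − x_q^k(t)‖ tends to 0 as t → ∞. -/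

import Mathlib

open Filter Topology
open scoped RealInnerProductSpace

lemma laplacian_nonpos {n K : ℕ} (B : Matrix (Fin K) (Fin K) ℝ) (hBsym : B.IsSymm)
    (hBrow : ∀ k, ∑ l, B k l = 0) (hBoff : ∀ k l, k ≠ l → 0 ≤ B k l)
    (z : Fin K → EuclideanSpace ℝ (Fin n)) :
    ∑ k, ⟪z k, ∑ l, B k l • z l⟫ ≤ 0 := by
  have hcol : ∀ l, ∑ k, B k l = 0 := fun l => by
    rw [← hBrow l]; exact Finset.sum_congr rfl fun k _ => hBsym.apply l k
  have h1 : ∀ k l, ⟪z k, B k l • z l⟫ =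
      (B k l * ‖z k‖ ^ 2 + B k l * ‖z l‖ ^ 2 - B k l * ‖z k - z l‖ ^ 2) / 2 := by
    intro k l
    rw [real_inner_smul_right, norm_sub_sq_real]; ring
  have h2 : ∑ k, ∑ l, B k l * ‖z k‖ ^ 2 = 0 :=
    Finset.sum_eq_zero fun k _ => by rw [← Finset.sum_mul, hBrow, zero_mul]
  have h3 : ∑ k, ∑ l, B k l * ‖z l‖ ^ 2 = 0 := by
    rw [Finset.sum_comm]
    exact Finset.sum_eq_zero fun k _ => by rw [← Finset.sum_mul, hcol, zero_mul]
  have h4 : 0 ≤ ∑ k, ∑ l, B k l * ‖z k - z l‖ ^ 2 := by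
    refine Finset.sum_nonneg fun k _ => Finset.sum_nonneg fun l _ => ?_
    by_cases h : k = l
    · simp [h]
    · exact mul_nonneg (hBoff k l h) (by positivity)
  simp only [inner_sum, h1, ← Finset.sum_div, Finset.sum_sub_distrib, Finset.sum_add_distrib,
    h2, h3]
  linarith

lemma pair_sum {N : ℕ} (u w : Fin N → ℝ) :
    ∑ i, ∑ j, (u i - u j) * (w i - w j) =
      2 * N * ∑ i, u i * w i - 2 * (∑ i, u i) * ∑ i, w i := by
  have : ∀ i j, (u i - u j) * (w i - w j) = u i * w i - u i * w j - u j * w i + u j * w j := by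
    intros; ring
  simp only [this, Finset.sum_sub_distrib, Finset.sum_add_distrib,
    Finset.sum_const, Finset.card_univ, Fintype.card_fin, nsmul_eq_mul]
  simp only [← Finset.mul_sum, ← Finset.sum_mul]
  ring

lemma scalar_bound {N : ℕ} (A : Matrix (Fin N) (Fin N) ℝ) (hAsym : A.IsSymm)
    (hArow : ∀ i, ∑ j, A i j = 0) (μ₂ : ℝ)
    (hμ₂ : ∀ v : Fin N → ℝ, (∑ i, v i) = 0 →
      ∑ i, ∑ j, v i * A i j * v j ≤ μ₂ * ∑ i, (v i) ^ 2) (u : Fin N → ℝ) :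
    ∑ i, ∑ j, (u i - u j) * ((∑ l, A i l * u l) - ∑ l, A j l * u l) ≤
      μ₂ * ∑ i, ∑ j, (u i - u j) ^ 2 := by
  rcases Nat.eq_zero_or_pos N with h0 | hN
  · subst h0; simp
  have hN' : (0 : ℝ) < N := by exact_mod_cast hN
  have hcol : ∀ l, ∑ k, A k l = 0 := fun l => by
    rw [← hArow l]; exact Finset.sum_congr rfl fun k _ => hAsym.apply l k
  have hw : ∑ i, ∑ l, A i l * u l = 0 := by
    rw [Finset.sum_comm]
    exact Finset.sum_eq_zero fun k _ => by rw [← Finset.sum_mul, hcol, zero_mul]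
  obtain ⟨m, hm⟩ : ∃ m : ℝ, ∑ i, u i = N * m := ⟨(∑ i, u i) / N, by field_simp⟩
  have hv0 : ∑ i, (u i - m) = 0 := by simp [Finset.sum_sub_distrib, hm]
  have key := hμ₂ (fun i => u i - m) hv0
  have e1 : ∑ i, ∑ j, (u i - m) * A i j * (u j - m) = ∑ i, u i * ∑ l, A i l * u l := by
    have a1 : ∀ i, ∑ j, (u i - m) * A i j * (u j - m) = (u i - m) * ∑ l, A i l * u l := by
      intro i
      have : ∀ j, (u i - m) * A i j * (u j - m) =
        (u i - m) * (A i j * u j) - (u i - m) * m * A i j := by intros; ring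
      simp only [this, Finset.sum_sub_distrib, ← Finset.mul_sum, hArow]
      ring
    rw [Finset.sum_congr rfl fun i _ => a1 i]
    simp only [sub_mul, Finset.sum_sub_distrib, ← Finset.mul_sum, hw]
    ring
  have e2 : ∑ i, ∑ j, (u i - u j) ^ 2 = 2 * N * ∑ i, (u i - m) ^ 2 := by
    have := pair_sum (fun i => u i - m) (fun i => u i - m)
    simp only [hv0, sub_sub_sub_cancel_right, ← sq] at this
    rw [this]; ring
  rw [pair_sum, hw, e2]
  rw [e1] at key
  have := mul_le_mul_of_nonneg_left key (by positivity : (0:ℝ) ≤ 2 * N)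
  linarith

lemma vector_bound {n N : ℕ} (A : Matrix (Fin N) (Fin N) ℝ) (hAsym : A.IsSymm)
    (hArow : ∀ i, ∑ j, A i j = 0) (μ₂ : ℝ)
    (hμ₂ : ∀ v : Fin N → ℝ, (∑ i, v i) = 0 →
      ∑ i, ∑ j, v i * A i j * v j ≤ μ₂ * ∑ i, (v i) ^ 2)
    (u : Fin N → EuclideanSpace ℝ (Fin n)) :
    ∑ i, ∑ j, ⟪u i - u j, (∑ l, A i l • u l) - ∑ l, A j l • u l⟫ ≤
      μ₂ * ∑ i, ∑ j, ‖u i - u j‖ ^ 2 := by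
  have e1 : ∀ i j, ⟪u i - u j, (∑ l, A i l • u l) - ∑ l, A j l • u l⟫ =
      ∑ s, (u i s - u j s) * ((∑ l, A i l * u l s) - ∑ l, A j l * u l s) := by
    intro i j
    simp [PiLp.inner_apply, mul_comm]
  have e2 : ∀ i j, ‖u i - u j‖ ^ 2 = ∑ s, (u i s - u j s) ^ 2 := by
    intro i j
    simp [EuclideanSpace.norm_sq_eq]
  have e3 : ∀ g : Fin N → Fin N → Fin n → ℝ,
      ∑ i, ∑ j, ∑ s, g i j s = ∑ s, ∑ i, ∑ j, g i j s := by
    intro g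
    rw [Finset.sum_comm]
    simp only [fun j => Finset.sum_comm (s := Finset.univ) (t := Finset.univ)
      (f := fun (i : Fin N) (s : Fin n) => g i j s)]
    rw [Finset.sum_comm]
    exact Finset.sum_congr rfl fun s _ => Finset.sum_comm
  simp only [e1, e2]
  rw [e3, e3, Finset.mul_sum]
  exact Finset.sum_le_sum fun s _ => scalar_bound A hAsym hArow μ₂ hμ₂ (fun i => u i s)

lemma single_le_triple {N K : ℕ} (g : Fin K → Fin N → Fin N → ℝ) (hg : ∀ k i j, 0 ≤ g k i j)
    (k : Fin K) (p q : Fin N) : g k p q ≤ ∑ k, ∑ i, ∑ j, g k i j := by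
  have s1 : g k p q ≤ ∑ j, g k p j :=
    Finset.single_le_sum (f := fun j => g k p j) (fun j _ => hg k p j) (Finset.mem_univ q)
  have s2 : ∑ j, g k p j ≤ ∑ i, ∑ j, g k i j :=
    Finset.single_le_sum (f := fun i => ∑ j, g k i j)
      (fun i _ => Finset.sum_nonneg fun j _ => hg k i j) (Finset.mem_univ p)
  have s3 : ∑ i, ∑ j, g k i j ≤ ∑ k, ∑ i, ∑ j, g k i j :=
    Finset.single_le_sum (f := fun k => ∑ i, ∑ j, g k i j)
      (fun k _ => Finset.sum_nonneg fun i _ => Finset.sum_nonneg fun j _ => hg k i j)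
      (Finset.mem_univ k)
  exact s1.trans (s2.trans s3)

lemma decay {V V' : ℝ → ℝ} {β : ℝ} (hβ : β < 0) (h0 : ∀ t, 0 ≤ V t)
    (hd : ∀ t, 0 ≤ t → HasDerivAt V (V' t) t) (hle : ∀ t, 0 ≤ t → V' t ≤ β * V t) :
    Tendsto V atTop (𝓝 0) := by
  have hder : ∀ t, 0 ≤ t → HasDerivAt (fun t => V t * Real.exp (-β * t))
      (V' t * Real.exp (-β * t) + V t * (Real.exp (-β * t) * (-β))) t := by
    intro t ht
    have h := ((hasDerivAt_id t).const_mul (-β)).exp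
    simp only [id, mul_one] at h
    exact (hd t ht).mul h
  have hanti : AntitoneOn (fun t => V t * Real.exp (-β * t)) (Set.Ici 0) := by
    apply antitoneOn_of_deriv_nonpos (convex_Ici 0)
    · exact fun t ht => (hder t ht).continuousAt.continuousWithinAt
    · intro t ht
      rw [interior_Ici] at ht
      exact (hder t (le_of_lt ht)).differentiableAt.differentiableWithinAt
    · intro t ht
      rw [interior_Ici] at ht
      rw [(hder t (le_of_lt ht)).deriv]
      have := mul_le_mul_of_nonneg_right (hle t (le_of_lt ht)) (Real.exp_pos (-β * t)).le
      linarith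
  have hlim : Tendsto (fun t => V 0 * Real.exp (β * t)) atTop (𝓝 0) := by
    have : Tendsto (fun t => Real.exp (β * t)) atTop (𝓝 0) :=
      Real.tendsto_exp_atBot.comp (tendsto_id.const_mul_atTop_of_neg hβ)
    simpa using this.const_mul (V 0)
  refine tendsto_of_tendsto_of_tendsto_of_le_of_le' tendsto_const_nhds hlim
    (Eventually.of_forall h0) ?_
  filter_upwards [eventually_ge_atTop 0] with t ht
  have h := hanti (Set.mem_Ici.2 le_rfl) (Set.mem_Ici.2 ht) ht
  simp only [mul_zero, Real.exp_zero, mul_one] at h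
  have h2 := mul_le_mul_of_nonneg_right h (Real.exp_pos (β * t)).le
  rwa [mul_assoc, ← Real.exp_add, show -β * t + β * t = 0 by ring, Real.exp_zero, mul_one] at h2

theorem multiplex_intralayer_synchronization
    (n N K : ℕ)
    (f : EuclideanSpace ℝ (Fin n) → EuclideanSpace ℝ (Fin n))
    (hf : Continuous f) (α : ℝ)
    (hquad : ∀ x y : EuclideanSpace ℝ (Fin n), ⟪x - y, f x - f y⟫ ≤ α * ‖x - y‖ ^ 2)
    (c d : ℝ) (hc : 0 ≤ c) (hd : 0 ≤ d)
    (A : Matrix (Fin N) (Fin N) ℝ) (B : Matrix (Fin K) (Fin K) ℝ)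
    (hAsym : A.IsSymm) (hBsym : B.IsSymm)
    (hArow : ∀ i, ∑ j, A i j = 0) (hBrow : ∀ k, ∑ l, B k l = 0)
    (hAoff : ∀ i j, i ≠ j → 0 ≤ A i j) (hBoff : ∀ k l, k ≠ l → 0 ≤ B k l)
    (μ₂ ν₂ : ℝ)
    (hμ₂ : ∀ v : Fin N → ℝ, (∑ i, v i) = 0 →
      ∑ i, ∑ j, v i * A i j * v j ≤ μ₂ * ∑ i, (v i) ^ 2)
    (hν₂ : ∀ v : Fin K → ℝ, (∑ k, v k) = 0 →
      ∑ k, ∑ l, v k * B k l * v l ≤ ν₂ * ∑ k, (v k) ^ 2)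
    (x : Fin N → Fin K → ℝ → EuclideanSpace ℝ (Fin n))
    (hode : ∀ i k, ∀ t : ℝ, 0 ≤ t → HasDerivAt (x i k)
      (f (x i k t) + c • ∑ j, A i j • x j k t + d • ∑ l, B k l • x i l t) t)
    (hsync : c * μ₂ + α < 0) :
    ∀ (k : Fin K) (p q : Fin N),
      Tendsto (fun t : ℝ => ‖x p k t - x q k t‖) atTop (𝓝 0) := by
  intro k p q
  let F : Fin N → Fin K → ℝ → EuclideanSpace ℝ (Fin n) := fun i k t =>
    f (x i k t) + c • ∑ j, A i j • x j k t + d • ∑ l, B k l • x i l t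
  let V : ℝ → ℝ := fun t => ∑ k, ∑ i, ∑ j, ‖x i k t - x j k t‖ ^ 2
  have hV0 : ∀ t, 0 ≤ V t := fun t => Finset.sum_nonneg fun _ _ =>
    Finset.sum_nonneg fun _ _ => Finset.sum_nonneg fun _ _ => sq_nonneg _
  have hVd : ∀ t, 0 ≤ t → HasDerivAt V
      (∑ k, ∑ i, ∑ j, 2 * ⟪x i k t - x j k t, F i k t - F j k t⟫) t := by
    intro t ht
    refine HasDerivAt.fun_sum fun k _ => HasDerivAt.fun_sum fun i _ =>
      HasDerivAt.fun_sum fun j _ => ?_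
    exact ((hode i k t ht).sub (hode j k t ht)).norm_sq
  have hle : ∀ t, 0 ≤ t → ∑ k, ∑ i, ∑ j, 2 * ⟪x i k t - x j k t, F i k t - F j k t⟫ ≤
      (2 * (c * μ₂ + α)) * V t := by
    intro t ht
    have hsplit : ∀ k i j, ⟪x i k t - x j k t, F i k t - F j k t⟫ =
        ⟪x i k t - x j k t, f (x i k t) - f (x j k t)⟫
        + c * ⟪x i k t - x j k t, (∑ l, A i l • x l k t) - ∑ l, A j l • x l k t⟫
        + d * ⟪x i k t - x j k t, ∑ l, B k l • (x i l t - x j l t)⟫ := by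
      intro k i j
      rw [← real_inner_smul_right, ← real_inner_smul_right, ← inner_add_right, ← inner_add_right]
      congr 1
      simp only [F, smul_sub, Finset.sum_sub_distrib]
      abel
    have b1 : ∑ k, ∑ i, ∑ j, ⟪x i k t - x j k t, f (x i k t) - f (x j k t)⟫ ≤ α * V t := by
      simp only [V, Finset.mul_sum]
      exact Finset.sum_le_sum fun k _ => Finset.sum_le_sum fun i _ =>
        Finset.sum_le_sum fun j _ => hquad _ _
    have b2 : ∑ k, ∑ i, ∑ j,
        ⟪x i k t - x j k t, (∑ l, A i l • x l k t) - ∑ l, A j l • x l k t⟫ ≤ μ₂ * V t := by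
      simp only [V]
      rw [Finset.mul_sum]
      exact Finset.sum_le_sum fun k _ => vector_bound A hAsym hArow μ₂ hμ₂ (fun i => x i k t)
    have b3 : ∑ k, ∑ i, ∑ j,
        ⟪x i k t - x j k t, ∑ l, B k l • (x i l t - x j l t)⟫ ≤ 0 := by
      rw [Finset.sum_comm]
      refine Finset.sum_nonpos fun i _ => ?_
      rw [Finset.sum_comm]
      exact Finset.sum_nonpos fun j _ =>
        laplacian_nonpos B hBsym hBrow hBoff (fun k => x i k t - x j k t)
    simp only [hsplit, Finset.sum_add_distrib, ← Finset.mul_sum]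
    have c2 := mul_le_mul_of_nonneg_left b2 hc
    have c3 := mul_nonpos_of_nonneg_of_nonpos hd b3
    linarith
  have hlim := decay (by linarith) hV0 hVd hle
  have hsqrt : Tendsto (fun t => Real.sqrt (V t)) atTop (𝓝 0) := by
    simpa using hlim.sqrt
  refine squeeze_zero (fun t => norm_nonneg _) (fun t => ?_) hsqrt
  apply Real.le_sqrt_of_sq_le
  exact single_le_triple (fun k i j => ‖x i k t - x j k t‖ ^ 2) (fun _ _ _ => sq_nonneg _) k p q
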